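/- If N ≥ 2, d ≥ max{63, 46N−79}, and n ≥ d+2, then q_d^{(1)}(n) ≥ Q_{d−N}^{(1,−)}(n). -/

import Mathlib

/-- `rho A n` is the number of partitions of `n` all of whose parts lie in `A`. -/
noncomputable def rho (A : Set ℕ) (n : ℕ) : ℕ :=
  Nat.card {p : n.Partition // ∀ x ∈ p.parts, x ∈ A}

/-- `qpart a d n` is the number of partitions of `n` into parts that are all `≥ a`
and pairwise differ by at least `d` (so, in particular, are distinct when `d ≥ 1`). -/
noncomputable def qpart (a d n : ℕ) : ℕ :=
  Nat.card {p : n.Partition //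
    (∀ x ∈ p.parts, a ≤ x) ∧
    (∀ x ∈ p.parts, p.parts.count x ≤ 1) ∧
    (∀ x ∈ p.parts, ∀ y ∈ p.parts, x ≠ y → d ≤ max x y - min x y)}

/-- Positive integers congruent to `±a` modulo `m`, excluding `m - a`. -/
noncomputable def QminusSet (a m : ℕ) : Set ℕ :=
  {x | x % m = a % m ∨ x % m = (m - a) % m} \ {m - a}

/-- `Qminus a d n` counts partitions of `n` into parts `≡ ±a (mod d+3)`,
excluding the part `d+3-a`. -/
noncomputable def Qminus (a d n : ℕ) : ℕ := rho (QminusSet a (d + 3)) n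

/-- `Qmm a d n` counts partitions of `n` into parts `≡ ±a (mod d+3)`,
excluding both the parts `a` and `d+3-a`. -/
noncomputable def Qmm (a d n : ℕ) : ℕ := rho (QminusSet a (d + 3) \ {a}) n

/-- `Tset s d` is the set of naturals congruent to `1` or to `d + 2^j` for some
`1 ≤ j ≤ s - 1` modulo `2d`. -/
def Tset (s d : ℕ) : Set ℕ :=
  {y | y % (2 * d) = 1 % (2 * d) ∨
    ∃ j, 1 ≤ j ∧ j + 1 ≤ s ∧ y % (2 * d) = (d + 2 ^ j) % (2 * d)}

/-- `T5 d` : naturals congruent to `1, d+2, d+4, d+8` or `d+16` modulo `2d`. -/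
def T5 (d : ℕ) : Set ℕ := Tset 5 d

/-- `Sset d N` : naturals congruent to `±1` modulo `d-N+3`, excluding `d-N+2`. -/
def Sset (d N : ℕ) : Set ℕ :=
  {x | x % (d - N + 3) = 1 % (d - N + 3) ∨ x % (d - N + 3) = (d - N + 2) % (d - N + 3)}
    \ {d - N + 2}

/-- `xN d N i` is the `i`-th smallest element of `Sset d N` (1-indexed). -/
noncomputable def xN (d N i : ℕ) : ℕ := Nat.nth (· ∈ Sset d N) (i - 1)

/-- `yT d i` is the `i`-th smallest element of `T5 d` (1-indexed). -/
noncomputable def yT (d i : ℕ) : ℕ := Nat.nth (· ∈ T5 d) (i - 1)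

open Finset

/-- A finite set of positive integers with sum `n` any two elements of which differ by at
least `d`. -/
def IsGapSet (d n : ℕ) (s : Finset ℕ) : Prop :=
  (∀ x ∈ s, 1 ≤ x) ∧ ∑ x ∈ s, x = n ∧ ∀ x ∈ s, ∀ y ∈ s, x < y → x + d ≤ y

open Classical in
/-- The gap sets of sum `n` with exactly `j` elements. -/
noncomputable def gapSets (d j n : ℕ) : Finset (Finset ℕ) :=
  {s ∈ (Icc 1 n).powerset | s.card = j ∧ IsGapSet d n s}

lemma mem_gapSets {d j n : ℕ} {s : Finset ℕ} :
    s ∈ gapSets d j n ↔ s.card = j ∧ IsGapSet d n s := by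
  classical
  simp only [gapSets, mem_filter, mem_powerset, and_iff_right_iff_imp]
  rintro ⟨-, h1, h2, -⟩ x hx
  exact mem_Icc.2 ⟨h1 x hx, h2 ▸ single_le_sum (f := fun x => x) (fun _ _ => Nat.zero_le _) hx⟩

lemma card_le_qpart {d n : ℕ} (F : Finset (Finset ℕ)) (hF : ∀ s ∈ F, IsGapSet d n s) :
    F.card ≤ qpart 1 d n := by
  rw [← Nat.card_eq_finsetCard F]
  let f : F → {p : n.Partition //
      (∀ x ∈ p.parts, 1 ≤ x) ∧ (∀ x ∈ p.parts, p.parts.count x ≤ 1) ∧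
      (∀ x ∈ p.parts, ∀ y ∈ p.parts, x ≠ y → d ≤ max x y - min x y)} := fun s =>
    ⟨⟨s.1.val, fun {i} hi => (hF s.1 s.2).1 i hi, by
        rw [← (hF s.1 s.2).2.1, Finset.sum, Multiset.map_id']⟩,
      (hF s.1 s.2).1, fun x _ => Multiset.nodup_iff_count_le_one.1 s.1.nodup x, by
        intro x hx y hy hxy
        rcases lt_or_gt_of_ne hxy with h | h
        · have := (hF s.1 s.2).2.2 x hx y hy h
          rw [max_eq_right h.le, min_eq_left h.le]; omega
        · have := (hF s.1 s.2).2.2 y hy x hx h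
          rw [max_eq_left h.le, min_eq_right h.le]; omega⟩
  refine Nat.card_le_card_of_injective f ?_
  intro s t h
  have h' : s.1.val = t.1.val := congrArg (fun p => p.1.parts) h
  exact Subtype.ext (Finset.val_injective h')

lemma two_le_qpart {d n : ℕ} (hd : 1 ≤ d) (hn : d + 2 ≤ n) : 2 ≤ qpart 1 d n := by
  classical
  have hne : ({n} : Finset ℕ) ≠ {1, n - 1} := by
    intro h
    have : 1 ∈ ({n} : Finset ℕ) := h ▸ mem_insert_self _ _
    rw [mem_singleton] at this
    omega
  rw [← card_pair hne]
  refine card_le_qpart _ fun s hs => ?_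
  rcases mem_insert.1 hs with rfl | hs
  · exact ⟨by simp; omega, by simp, by simp⟩
  · rw [mem_singleton.1 hs]
    refine ⟨?_, ?_, ?_⟩
    · simp; omega
    · rw [sum_pair (by omega)]; omega
    · simp; omega

/-- Increase every element of a set by `a`. -/
def shiftSet (a : ℕ) (s : Finset ℕ) : Finset ℕ := s.map (addRightEmbedding a)

lemma IsGapSet.shiftSet {d n : ℕ} {s : Finset ℕ} (h : IsGapSet d n s) (a : ℕ) :
    IsGapSet d (n + s.card * a) (shiftSet a s) := by
  obtain ⟨h1, h2, h3⟩ := h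
  refine ⟨?_, ?_, ?_⟩
  · intro x hx
    obtain ⟨y, hy, rfl⟩ := mem_map.1 hx
    exact (h1 y hy).trans (Nat.le_add_right _ _)
  · simp [_root_.shiftSet, sum_add_distrib, h2]
  · intro x hx y hy hxy
    obtain ⟨x', hx', rfl⟩ := mem_map.1 hx
    obtain ⟨y', hy', rfl⟩ := mem_map.1 hy
    simp only [addRightEmbedding_apply] at hxy ⊢
    have := h3 x' hx' y' hy' (by omega)
    omega

lemma IsGapSet.insert_one {d n : ℕ} {s : Finset ℕ} (hd : 1 ≤ d) (h : IsGapSet d n s) :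
    IsGapSet d (n + s.card * d + 1) (insert 1 (_root_.shiftSet d s)) ∧
      (insert 1 (_root_.shiftSet d s)).card = s.card + 1 := by
  have hge : ∀ x ∈ _root_.shiftSet d s, 1 + d ≤ x := by
    intro x hx
    obtain ⟨y, hy, rfl⟩ := mem_map.1 hx
    have := h.1 y hy
    simp only [addRightEmbedding_apply]
    omega
  have hnot : 1 ∉ _root_.shiftSet d s := fun h1 => by have := hge 1 h1; omega
  obtain ⟨h1, h2, h3⟩ := h.shiftSet d
  refine ⟨⟨?_, ?_, ?_⟩, by rw [card_insert_of_notMem hnot, _root_.shiftSet, card_map]⟩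
  · intro x hx
    rcases mem_insert.1 hx with rfl | hx
    exacts [le_rfl, h1 x hx]
  · rw [sum_insert hnot, h2, add_comm]
  · intro x hx y hy hxy
    rcases mem_insert.1 hx with rfl | hx <;> rcases mem_insert.1 hy with rfl | hy
    · omega
    · exact hge y hy
    · have := hge x hx; omega
    · exact h3 x hx y hy hxy

lemma insert_one_shiftSet_injective {d n : ℕ} {s t : Finset ℕ} (hd : 1 ≤ d)
    (hs : IsGapSet d n s) (ht : IsGapSet d n t)
    (h : insert 1 (shiftSet d s) = insert 1 (shiftSet d t)) : s = t := by
  have key : ∀ s : Finset ℕ, IsGapSet d n s → 1 ∉ shiftSet d s := by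
    intro s hs h1
    obtain ⟨y, hy, h2⟩ := mem_map.1 h1
    have := hs.1 y hy
    simp only [addRightEmbedding_apply] at h2
    omega
  have h' := congrArg (fun u => u.erase 1) h
  simp only [erase_insert (key s hs), erase_insert (key t ht)] at h'
  exact map_injective _ h'

lemma card_gapSets_le_succ {d : ℕ} (hd : 1 ≤ d) (j n : ℕ) :
    (gapSets d j n).card ≤ (gapSets d (j + 1) (n + j * d + 1)).card := by
  refine card_le_card_of_injOn (fun s => insert 1 (shiftSet d s)) ?_ ?_
  · intro s hs
    obtain ⟨rfl, h⟩ := mem_gapSets.1 hs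
    exact mem_gapSets.2 (h.insert_one hd).symm
  · intro s hs t ht h
    exact insert_one_shiftSet_injective hd (mem_gapSets.1 hs).2 (mem_gapSets.1 ht).2 h

lemma card_gapSets_add_le {d : ℕ} (hd : 1 ≤ d) {j k n : ℕ} (h : k + (j + 1) = n + j * d + 1) :
    (gapSets d (j + 1) k).card + (gapSets d j n).card ≤
      (gapSets d (j + 1) (n + j * d + 1)).card := by
  classical
  rw [← card_image_of_injOn (s := gapSets d (j + 1) k) (f := shiftSet 1)
      ((map_injective _).injOn),
    ← card_image_of_injOn (s := gapSets d j n) (f := fun s => insert 1 (shiftSet d s))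
      (fun s hs t ht h => insert_one_shiftSet_injective hd (mem_gapSets.1 hs).2
        (mem_gapSets.1 ht).2 h), ← card_union_of_disjoint]
  · refine card_le_card (union_subset ?_ ?_)
    · intro u hu
      obtain ⟨s, hs, rfl⟩ := mem_image.1 hu
      obtain ⟨hc, hg⟩ := mem_gapSets.1 hs
      have := hg.shiftSet 1
      rw [hc, mul_one, h] at this
      exact mem_gapSets.2 ⟨by rw [shiftSet, card_map, hc], this⟩
    · intro u hu
      obtain ⟨s, hs, rfl⟩ := mem_image.1 hu
      obtain ⟨rfl, hg⟩ := mem_gapSets.1 hs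
      exact mem_gapSets.2 (hg.insert_one hd).symm
  · rw [disjoint_left]
    intro u hu hv
    obtain ⟨s, hs, rfl⟩ := mem_image.1 hu
    obtain ⟨t, ht, h2⟩ := mem_image.1 hv
    have h1 : 1 ∈ shiftSet 1 s := h2 ▸ mem_insert_self _ _
    obtain ⟨y, hy, h3⟩ := mem_map.1 h1
    have := (mem_gapSets.1 hs).2.1 y hy
    simp only [addRightEmbedding_apply] at h3
    omega

lemma add_pow_succ_le (a b k : ℕ) :
    (a + b) ^ (k + 1) ≤ a ^ (k + 1) + (k + 1) * b * (a + b) ^ k := by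
  induction k with
  | zero => simp
  | succ k ih =>
    calc (a + b) ^ (k + 1 + 1) = a * (a + b) ^ (k + 1) + b * (a + b) ^ (k + 1) := by ring
      _ ≤ a * (a ^ (k + 1) + (k + 1) * b * (a + b) ^ k) + b * (a + b) ^ (k + 1) := by gcongr
      _ = a ^ (k + 1 + 1) + (k + 1) * b * (a * (a + b) ^ k) + b * (a + b) ^ (k + 1) := by ring
      _ ≤ a ^ (k + 1 + 1) + (k + 1) * b * ((a + b) * (a + b) ^ k) + b * (a + b) ^ (k + 1) := by
        gcongr; omega
      _ = _ := by ring

lemma pow_le_card_gapSets {d : ℕ} (hd : 1 ≤ d) (j M : ℕ) :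
    (M + 1) ^ j ≤ (j + 1).factorial * j.factorial *
      (gapSets d (j + 1) (M + (j + 1) + d * (j + 1).choose 2)).card := by
  induction j generalizing M with
  | zero =>
    have : {M + 1} ∈ gapSets d (0 + 1) (M + (0 + 1) + d * (0 + 1).choose 2) :=
      mem_gapSets.2 ⟨by simp, by simp, by simp, by simp⟩
    simpa using card_pos.2 ⟨_, this⟩
  | succ j ih =>
    have hch : (j + 1 + 1).choose 2 = (j + 1).choose 2 + (j + 1) := by
      rw [Nat.choose_succ_succ' (j + 1) 1, Nat.choose_one_right, add_comm]
    have hsum : ∀ M, M + (j + 1 + 1) + d * (j + 1 + 1).choose 2 =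
        M + (j + 1) + d * (j + 1).choose 2 + (j + 1) * d + 1 := by
      intro M; rw [hch]; ring
    have hfac : (j + 1 + 1).factorial * (j + 1).factorial =
        (j + 2) * (j + 1) * ((j + 1).factorial * j.factorial) := by
      rw [Nat.factorial_succ (j + 1), Nat.factorial_succ j]; ring
    induction M using Nat.strong_induction_on with
    | _ M ihM =>
    rcases lt_or_ge M (j + 2) with hM | hM
    · rw [hsum, hfac]
      calc (M + 1) ^ (j + 1) = (M + 1) * (M + 1) ^ j := by ring
        _ ≤ ((j + 2) * (j + 1)) * (M + 1) ^ j := by gcongr; nlinarith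
        _ ≤ ((j + 2) * (j + 1)) * ((j + 1).factorial * j.factorial *
            (gapSets d (j + 1) (M + (j + 1) + d * (j + 1).choose 2)).card) := by
          gcongr; exact ih M
        _ ≤ ((j + 2) * (j + 1)) * ((j + 1).factorial * j.factorial *
            (gapSets d (j + 1 + 1)
              (M + (j + 1) + d * (j + 1).choose 2 + (j + 1) * d + 1)).card) := by
          exact Nat.mul_le_mul_left _ (Nat.mul_le_mul_left _ (card_gapSets_le_succ hd _ _))
        _ = _ := by ring
    · obtain ⟨K, rfl⟩ := Nat.exists_eq_add_of_le' hM
      have h1 := ihM K (by omega)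
      have h2 := ih (K + (j + 2))
      have h3 := card_gapSets_add_le hd (j := j + 1)
        (k := K + (j + 1 + 1) + d * (j + 1 + 1).choose 2)
        (n := K + (j + 2) + (j + 1) + d * (j + 1).choose 2) (by rw [hch]; ring)
      rw [hsum (K + (j + 2))]
      refine le_trans ?_ (Nat.mul_le_mul_left _ h3)
      rw [mul_add]
      refine le_trans ?_ (Nat.add_le_add_right h1 _)
      rw [hfac, mul_assoc ((j + 2) * (j + 1))]
      refine le_trans ?_ (Nat.add_le_add_left (Nat.mul_le_mul_left _ h2) _)
      have := add_pow_succ_le (K + 1) (j + 2) j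
      rw [show K + (j + 2) + 1 = K + 1 + (j + 2) by ring]
      linarith

lemma pow_le_qpart {d n M : ℕ} (hd : 1 ≤ d) (j : ℕ)
    (hn : n = M + (j + 1) + d * (j + 1).choose 2) :
    (M + 1) ^ j ≤ (j + 1).factorial * j.factorial * qpart 1 d n := by
  subst hn
  exact (pow_le_card_gapSets hd j M).trans
    (Nat.mul_le_mul_left _ (card_le_qpart _ fun s hs => (mem_gapSets.1 hs).2))

lemma rho_mono {A B : Set ℕ} {n : ℕ} (h : ∀ x ∈ A, 1 ≤ x → x ≤ n → x ∈ B) :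
    rho A n ≤ rho B n := by
  refine Nat.card_le_card_of_injective
    (fun p => ⟨p.1, fun x hx => h x (p.2 x hx) (p.1.parts_pos hx) ?_⟩) ?_
  · exact p.1.parts_sum ▸ Multiset.le_sum_of_mem hx
  · intro p q hpq
    exact Subtype.ext (congrArg (fun r => r.1) hpq)

lemma rho_singleton_one_le (n : ℕ) : rho {1} n ≤ 1 := by
  refine Finite.card_le_one_iff_subsingleton.2 ⟨fun p q => ?_⟩
  have key : ∀ p : {p : n.Partition // ∀ x ∈ p.parts, x ∈ ({1} : Set ℕ)},
      p.1.parts = Multiset.replicate n 1 := by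
    intro p
    have h := Multiset.eq_replicate_card.2 p.2
    have hs := p.1.parts_sum
    rw [h, Multiset.sum_replicate, smul_eq_mul, mul_one] at hs
    rw [h, hs]
  exact Subtype.ext (Nat.Partition.ext ((key p).trans (key q).symm))

open Classical in
lemma rho_insert_le (A : Set ℕ) (a n : ℕ) :
    rho (insert a A) n ≤ rho A n + if a ≤ n then rho (insert a A) (n - a) else 0 := by
  split_ifs with han
  · unfold rho
    rw [← Nat.card_sum]
    let f : {p : n.Partition // ∀ x ∈ p.parts, x ∈ insert a A} →
        {p : n.Partition // ∀ x ∈ p.parts, x ∈ A} ⊕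
        {p : (n - a).Partition // ∀ x ∈ p.parts, x ∈ insert a A} := fun p =>
      if h : a ∈ p.1.parts then
        Sum.inr ⟨⟨p.1.parts.erase a, fun {i} hi => p.1.parts_pos (Multiset.mem_of_mem_erase hi), by
          have := Multiset.sum_erase h
          rw [p.1.parts_sum] at this
          omega⟩, fun x hx => p.2 x (Multiset.mem_of_mem_erase hx)⟩
      else Sum.inl ⟨p.1, fun x hx => (p.2 x hx).resolve_left (fun hxa => h (hxa ▸ hx))⟩
    refine Nat.card_le_card_of_injective f fun p q hpq => ?_
    by_cases hp : a ∈ p.1.parts <;> by_cases hq : a ∈ q.1.parts <;>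
      simp only [f, hp, hq, dite_true, dite_false, Sum.inr.injEq, Sum.inl.injEq, reduceCtorEq,
        Subtype.mk.injEq, Nat.Partition.mk.injEq] at hpq
    · refine Subtype.ext (Nat.Partition.ext ?_)
      rw [← Multiset.cons_erase hp, hpq, Multiset.cons_erase hq]
    · exact Subtype.ext hpq
  · rw [add_zero]
    refine rho_mono fun x hx _ hxn => hx.resolve_left ?_
    rintro rfl
    exact han hxn

/-- Adjoining a part of weight `w` costs at most a factor `1 / (1 - u ^ w)`, when the weight of
`n` is measured by `2 * n / q`. -/
lemma rho_insert_mul_pow_le {A : Set ℕ} {a q w : ℕ} {u C : ℝ} (hq : 0 < q) (hw : 1 ≤ w)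
    (haw : w * q ≤ 2 * a) (hu0 : 0 < u) (hu1 : u < 1)
    (hA : ∀ n, (rho A n : ℝ) * u ^ (2 * n / q) ≤ C) (n : ℕ) :
    (rho (insert a A) n : ℝ) * u ^ (2 * n / q) ≤ C * (1 - u ^ w)⁻¹ := by
  have hpos : 0 < 1 - u ^ w := sub_pos.2 (pow_lt_one₀ hu0.le hu1 (by omega))
  have ha : 0 < a := by
    by_contra h
    have : 0 < w * q := by positivity
    omega
  have hC : 0 ≤ C := le_trans (by positivity) (hA 0)
  induction n using Nat.strong_induction_on with
  | _ n ih =>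
  have h := rho_insert_le A a n
  split_ifs at h with han
  · have h' : (rho (insert a A) n : ℝ) ≤ rho A n + rho (insert a A) (n - a) := by exact_mod_cast h
    have hT : w + 2 * (n - a) / q ≤ 2 * n / q := by
      rw [Nat.le_div_iff_mul_le hq, add_mul]
      have := Nat.div_mul_le_self (2 * (n - a)) q
      omega
    have ih' := ih (n - a) (by omega)
    calc (rho (insert a A) n : ℝ) * u ^ (2 * n / q)
        ≤ (rho A n + rho (insert a A) (n - a)) * u ^ (2 * n / q) := by gcongr
      _ = rho A n * u ^ (2 * n / q) + rho (insert a A) (n - a) * u ^ (2 * n / q) := by ring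
      _ ≤ C + rho (insert a A) (n - a) * u ^ (w + 2 * (n - a) / q) := by
        gcongr ?_ + _ * ?_
        · exact hA n
        · exact pow_le_pow_of_le_one hu0.le hu1.le hT
      _ = C + u ^ w * (rho (insert a A) (n - a) * u ^ (2 * (n - a) / q)) := by ring
      _ ≤ C + u ^ w * (C * (1 - u ^ w)⁻¹) := by gcongr
      _ = C * (1 - u ^ w)⁻¹ := by field_simp; ring
  · have h' : (rho (insert a A) n : ℝ) ≤ rho A n := by exact_mod_cast h
    calc (rho (insert a A) n : ℝ) * u ^ (2 * n / q) ≤ rho A n * u ^ (2 * n / q) := by gcongr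
      _ ≤ C := hA n
      _ ≤ C * (1 - u ^ w)⁻¹ := by
        refine le_mul_of_one_le_right hC ((one_le_inv₀ hpos).2 ?_)
        have : 0 < u ^ w := by positivity
        linarith

/-- The parts `1`, `m + 1` and `k * m ± 1` for `2 ≤ k ≤ K + 1`. -/
def lowParts (m : ℕ) : ℕ → Set ℕ
  | 0 => insert (m + 1) {1}
  | K + 1 => insert ((K + 2) * m + 1) (insert ((K + 2) * m - 1) (lowParts m K))

lemma rho_lowParts_mul_pow_le {m : ℕ} (hm : 1 ≤ m) {u : ℝ} (hu0 : 0 < u) (hu1 : u < 1)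
    (K n : ℕ) : (rho (lowParts m K) n : ℝ) * u ^ (2 * n / (2 * m - 1)) ≤
      (1 - u) * ∏ k ∈ range (K + 1), ((1 - u ^ (k + 1))⁻¹) ^ 2 := by
  induction K generalizing n with
  | zero =>
    have h1 : ∀ n, (rho {1} n : ℝ) * u ^ (2 * n / (2 * m - 1)) ≤ 1 := fun n =>
      mul_le_one₀ (by exact_mod_cast rho_singleton_one_le n) (by positivity)
        (pow_le_one₀ hu0.le hu1.le)
    refine (rho_insert_mul_pow_le (a := m + 1) (w := 1) (by omega) le_rfl (by omega) hu0 hu1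
      h1 n).trans_eq ?_
    have : 1 - u ≠ 0 := by linarith
    simp
    field_simp
  | succ K ih =>
    have hle : (K + 2) * (2 * m - 1) + (K + 2) = 2 * ((K + 2) * m) := by
      rw [← mul_add_one]
      have : 2 * m - 1 + 1 = 2 * m := by omega
      rw [this]; ring
    have h1 := rho_insert_mul_pow_le (a := (K + 2) * m - 1) (w := K + 2) (by omega) (by omega)
      (by omega) hu0 hu1 ih
    refine (rho_insert_mul_pow_le (a := (K + 2) * m + 1) (w := K + 2) (by omega) (by omega)
      (by omega) hu0 hu1 h1 n).trans_eq ?_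
    rw [prod_range_succ _ (K + 1)]
    ring

lemma one_mem_lowParts (m K : ℕ) : 1 ∈ lowParts m K := by
  induction K with
  | zero => simp [lowParts]
  | succ K ih => exact Or.inr (Or.inr ih)

lemma mul_add_one_mem_lowParts (m : ℕ) {k K : ℕ} (hk : k ≤ K) :
    (k + 1) * m + 1 ∈ lowParts m K := by
  induction K with
  | zero => obtain rfl : k = 0 := by omega
            simp [lowParts]
  | succ K ih =>
    rcases Nat.lt_or_ge K k with h | h
    · obtain rfl : k = K + 1 := by omega
      exact Or.inl rfl
    · exact Or.inr (Or.inr (ih h))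

lemma mul_sub_one_mem_lowParts (m : ℕ) {k K : ℕ} (hk : k + 1 ≤ K) :
    (k + 2) * m - 1 ∈ lowParts m K := by
  induction K with
  | zero => omega
  | succ K ih =>
    rcases Nat.lt_or_ge K (k + 1) with h | h
    · obtain rfl : k = K := by omega
      exact Or.inr (Or.inl rfl)
    · exact Or.inr (Or.inr (ih h))

lemma QminusSet_cases {m x : ℕ} (hm : 3 ≤ m) (hx : x ∈ QminusSet 1 m) :
    x = 1 ∨ (∃ k, x = (k + 1) * m + 1) ∨ ∃ k, x = (k + 2) * m - 1 := by
  obtain ⟨h1, h2⟩ := hx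
  have h2 : x ≠ m - 1 := h2
  have h3 := Nat.div_add_mod' x m
  rcases h1 with h1 | h1
  · rw [Nat.mod_eq_of_lt (by omega : 1 < m)] at h1
    rw [h1] at h3
    rcases Nat.eq_zero_or_pos (x / m) with h0 | h0
    · left; rw [h0] at h3; omega
    · right; left
      exact ⟨x / m - 1, by rw [Nat.sub_add_cancel h0]; exact h3.symm⟩
  · rw [Nat.mod_eq_of_lt (by omega : m - 1 < m)] at h1
    rw [h1] at h3
    rcases Nat.eq_zero_or_pos (x / m) with h0 | h0
    · rw [h0] at h3; omega
    · right; right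
      refine ⟨x / m - 1, ?_⟩
      rw [show x / m - 1 + 2 = x / m + 1 by omega, add_one_mul]
      omega

lemma rho_QminusSet_le_lowParts {m n K : ℕ} (hm : 3 ≤ m) (hK : 2 * n / (2 * m - 1) ≤ K + 1) :
    rho (QminusSet 1 m) n ≤ rho (lowParts m K) n := by
  refine rho_mono fun x hx _ hxn => ?_
  have hweight : ∀ w, w * (2 * m - 1) ≤ 2 * x → w ≤ K + 1 := fun w hw =>
    ((Nat.le_div_iff_mul_le (by omega)).2 (hw.trans (by omega))).trans hK
  have hexp : ∀ w, w * (2 * m - 1) + w = 2 * (w * m) := fun w => by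
    rw [← mul_add_one, show 2 * m - 1 + 1 = 2 * m by omega]; ring
  rcases QminusSet_cases hm hx with rfl | ⟨k, rfl⟩ | ⟨k, rfl⟩
  · exact one_mem_lowParts _ _
  · have h := hexp (k + 1)
    have := hweight (k + 1) (by omega)
    exact mul_add_one_mem_lowParts _ (by omega)
  · have h := hexp (k + 2)
    have := hweight (k + 2) (by omega)
    exact mul_sub_one_mem_lowParts _ (by omega)

lemma rho_QminusSet_le_two {m n : ℕ} (hm : 3 ≤ m) (hn : 2 * n / (2 * m - 1) ≤ 1) :
    rho (QminusSet 1 m) n ≤ 2 := by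
  have hn' : n < 2 * m - 1 := by
    have := (Nat.div_lt_iff_lt_mul (by omega : 0 < 2 * m - 1)).1 (Nat.lt_succ_of_le hn)
    omega
  refine (rho_QminusSet_le_lowParts (K := 0) hm hn).trans ?_
  have h1 := rho_insert_le {1} (m + 1) n
  have h2 := rho_insert_le {1} (m + 1) (n - (m + 1))
  rw [if_neg (by omega)] at h2
  have h3 := rho_singleton_one_le n
  have h4 := rho_singleton_one_le (n - (m + 1))
  change rho (insert (m + 1) {1}) n ≤ 2
  split_ifs at h1 <;> omega

lemma rho_QminusSet_le {m n K : ℕ} (hm : 3 ≤ m) (hK : 2 * n / (2 * m - 1) ≤ K + 1) {u : ℝ}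
    (hu0 : 0 < u) (hu1 : u < 1) : (rho (QminusSet 1 m) n : ℝ) ≤
      (u⁻¹) ^ (2 * n / (2 * m - 1)) *
        ((1 - u) * ∏ k ∈ range (K + 1), ((1 - u ^ (k + 1))⁻¹) ^ 2) := by
  have h1 : (rho (QminusSet 1 m) n : ℝ) ≤ rho (lowParts m K) n := by
    exact_mod_cast rho_QminusSet_le_lowParts hm hK
  refine h1.trans ?_
  rw [inv_pow, ← div_eq_inv_mul, le_div_iff₀ (by positivity)]
  exact rho_lowParts_mul_pow_le (by omega) hu0 hu1 K n

lemma prod_inv_one_sub_pow_le {u : ℝ} (hu0 : 0 < u) (hu1 : u < 1) (K : ℕ) :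
    ∏ k ∈ range K, (1 - u ^ (k + 1))⁻¹ ≤ Real.exp (Real.pi ^ 2 / 6 * (u / (1 - u))) := by
  have hlt : ∀ k, u ^ (k + 1) < 1 := fun k => pow_lt_one₀ hu0.le hu1 k.succ_ne_zero
  have hpos : ∀ k ∈ range K, 0 < (1 - u ^ (k + 1))⁻¹ := fun k _ => inv_pos.2 (sub_pos.2 (hlt k))
  have h1u : 0 < 1 - u := sub_pos.2 hu1
  rw [← Real.log_le_iff_le_exp (prod_pos hpos), Real.log_prod fun k hk => (hpos k hk).ne']
  have hlog : HasSum (fun r : ℕ => ∑ k ∈ range K, (u ^ (k + 1)) ^ (r + 1) / ((r : ℝ) + 1))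
      (∑ k ∈ range K, Real.log (1 - u ^ (k + 1))⁻¹) := by
    refine hasSum_sum fun k _ => ?_
    rw [Real.log_inv]
    exact Real.hasSum_pow_div_log_of_abs_lt_one (by rw [abs_of_pos (by positivity)]; exact hlt k)
  have hzeta : HasSum (fun r : ℕ => 1 / ((r : ℝ) + 1) ^ 2 * (u / (1 - u)))
      (Real.pi ^ 2 / 6 * (u / (1 - u))) := by
    refine HasSum.mul_right _ ?_
    have := (hasSum_nat_add_iff' 1).2 hasSum_zeta_two
    simpa using this
  refine hasSum_le (fun r => ?_) hlog hzeta
  rw [← sum_div, div_le_iff₀ (by positivity)]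
  have hr : u ^ (r + 1) < 1 := hlt r
  have hr' : 0 < 1 - u ^ (r + 1) := sub_pos.2 hr
  have hgeom : ∑ k ∈ range K, (u ^ (k + 1)) ^ (r + 1) ≤ u ^ (r + 1) / (1 - u ^ (r + 1)) := by
    have h1 : ∑ k ∈ range K, (u ^ (k + 1)) ^ (r + 1) =
        u ^ (r + 1) * ∑ k ∈ range K, (u ^ (r + 1)) ^ k := by
      rw [mul_sum]
      refine sum_congr rfl fun k _ => ?_
      rw [← pow_mul, ← pow_mul, ← pow_add]
      ring_nf
    rw [h1, div_eq_mul_inv, geom_sum_eq hr.ne, ← neg_div_neg_eq, neg_sub, neg_sub,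
      ← one_div (1 - u ^ (r + 1))]
    gcongr
    have : 0 < (u ^ (r + 1)) ^ K := by positivity
    linarith
  refine hgeom.trans ?_
  have hsum : (r + 1) * u ^ r * (1 - u) ≤ 1 - u ^ (r + 1) := by
    rw [← mul_neg_geom_sum u (r + 1), mul_comm]
    gcongr
    calc ((r : ℝ) + 1) * u ^ r = ∑ _i ∈ range (r + 1), u ^ r := by simp
      _ ≤ ∑ i ∈ range (r + 1), u ^ i := sum_le_sum fun i hi =>
        pow_le_pow_of_le_one hu0.le hu1.le (by have := mem_range.1 hi; omega)
  rw [div_le_iff₀ hr']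
  have : 1 / ((r : ℝ) + 1) ^ 2 * (u / (1 - u)) * (r + 1) * ((r + 1) * u ^ r * (1 - u)) =
      u ^ (r + 1) := by
    field_simp
    ring
  exact this.symm.le.trans (mul_le_mul_of_nonneg_left hsum (by positivity))

lemma pow_le_qpart_of_le {d n T j a : ℕ} (hd : 63 ≤ d) (hn : T * (45 * d + 36) ≤ 46 * n)
    (ha : 1 ≤ a) (hj : 23 * (j * (j + 1)) ≤ 45 * T)
    (hT : 46 * a + 46 * j + 63 * (23 * (j * (j + 1))) ≤ T * (45 * 63 + 36)) :
    a ^ j ≤ (j + 1).factorial * j.factorial * qpart 1 d n := by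
  have hch : (j + 1).choose 2 * 2 = j * (j + 1) := by
    rw [Nat.choose_two_right, Nat.div_mul_cancel (Nat.even_mul_pred_self (j + 1)).two_dvd]
    simp [mul_comm]
  obtain ⟨e, rfl⟩ := Nat.exists_eq_add_of_le hd
  have he := Nat.mul_le_mul_left e hj
  have hle : a + j + (63 + e) * (j + 1).choose 2 ≤ n := by nlinarith
  obtain ⟨M, hM⟩ : ∃ M, n = M + (j + 1) + (63 + e) * (j + 1).choose 2 :=
    ⟨n - ((j + 1) + (63 + e) * (j + 1).choose 2), by omega⟩
  exact (Nat.pow_le_pow_left (by omega) j).trans (pow_le_qpart (by omega) j hM)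

lemma rho_le_qpart_of_bound {d m n T j a : ℕ} {B : ℝ} (hd : 63 ≤ d)
    (hn : T * (45 * d + 36) ≤ 46 * n)
    (ha : 1 ≤ a) (hj : 23 * (j * (j + 1)) ≤ 45 * T)
    (hT : 46 * a + 46 * j + 63 * (23 * (j * (j + 1))) ≤ T * (45 * 63 + 36))
    (hB : (rho (QminusSet 1 m) n : ℝ) ≤ B)
    (hBa : B * ((j + 1).factorial * j.factorial) ≤ (a : ℝ) ^ j) :
    rho (QminusSet 1 m) n ≤ qpart 1 d n := by
  have h1 : (a : ℝ) ^ j ≤ ((j + 1).factorial * j.factorial) * qpart 1 d n := by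
    exact_mod_cast pow_le_qpart_of_le hd hn ha hj hT
  have hpos : (0 : ℝ) < (j + 1).factorial * j.factorial := by positivity
  have h2 : (rho (QminusSet 1 m) n : ℝ) * ((j + 1).factorial * j.factorial) ≤
      qpart 1 d n * ((j + 1).factorial * j.factorial) := by
    rw [mul_comm (qpart 1 d n : ℝ)]
    exact (mul_le_mul_of_nonneg_right hB hpos.le).trans (hBa.trans h1)
  exact_mod_cast le_of_mul_le_mul_right h2 hpos

lemma rho_le_qpart_of_mem_interval {d m n T K : ℕ} (j a : ℕ) (u : ℝ) (hd : 63 ≤ d) (hm : 3 ≤ m)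
    (hn : T * (45 * d + 36) ≤ 46 * n) (hK : 2 * n / (2 * m - 1) ≤ K + 1)
    (hu0 : 0 < u) (hu1 : u < 1)
    (ha : 1 ≤ a) (hj : 23 * (j * (j + 1)) ≤ 45 * T)
    (hT : 46 * a + 46 * j + 63 * (23 * (j * (j + 1))) ≤ T * (45 * 63 + 36))
    (hnum : (u⁻¹) ^ (K + 1) * ((1 - u) * ∏ k ∈ range (K + 1), ((1 - u ^ (k + 1))⁻¹) ^ 2) *
      ((j + 1).factorial * j.factorial) ≤ (a : ℝ) ^ j) :
    rho (QminusSet 1 m) n ≤ qpart 1 d n := by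
  refine rho_le_qpart_of_bound hd hn ha hj hT ((rho_QminusSet_le hm hK hu0 hu1).trans ?_) hnum
  have h1u : 0 < 1 - u := sub_pos.2 hu1
  refine mul_le_mul_of_nonneg_right ?_ (mul_nonneg h1u.le (prod_nonneg fun _ _ => sq_nonneg _))
  exact pow_le_pow_right₀ ((one_le_inv₀ hu0).2 hu1.le) hK

lemma rho_le_qpart_of_le_forty_eight {d m n : ℕ} (hd : 63 ≤ d) (hm : 3 ≤ m)
    (hn : 2 * n / (2 * m - 1) * (45 * d + 36) ≤ 46 * n)
    (hT2 : 2 ≤ 2 * n / (2 * m - 1)) (hT48 : 2 * n / (2 * m - 1) ≤ 48) :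
    rho (QminusSet 1 m) n ≤ qpart 1 d n := by
  generalize hT : 2 * n / (2 * m - 1) = T at hn hT2 hT48
  have hn' : ∀ S ≤ T, S * (45 * d + 36) ≤ 46 * n := fun S hS =>
    (Nat.mul_le_mul_right _ hS).trans hn
  rcases lt_or_ge T 3 with h | h
  · refine rho_le_qpart_of_mem_interval (K := 1) 1 60 (1 / 2) hd hm (hn' 2 hT2) (by omega)
      (by norm_num) (by norm_num) (by norm_num) (by norm_num) (by norm_num) ?_
    norm_num [prod_range_succ, Nat.factorial]
  rcases lt_or_ge T 4 with h4 | h4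
  · refine rho_le_qpart_of_mem_interval (K := 2) 1 120 (1 / 2) hd hm (hn' 3 h) (by omega)
      (by norm_num) (by norm_num) (by norm_num) (by norm_num) (by norm_num) ?_
    norm_num [prod_range_succ, Nat.factorial]
  rcases lt_or_ge T 6 with h6 | h6
  · refine rho_le_qpart_of_mem_interval (K := 4) 2 58 (11 / 20) hd hm (hn' 4 h4) (by omega)
      (by norm_num) (by norm_num) (by norm_num) (by norm_num) (by norm_num) ?_
    norm_num [prod_range_succ, Nat.factorial]
  rcases lt_or_ge T 10 with h10 | h10
  · refine rho_le_qpart_of_mem_interval (K := 8) 2 180 (3 / 5) hd hm (hn' 6 h6) (by omega)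
      (by norm_num) (by norm_num) (by norm_num) (by norm_num) (by norm_num) ?_
    norm_num [prod_range_succ, Nat.factorial]
  rcases lt_or_ge T 18 with h18 | h18
  · refine rho_le_qpart_of_mem_interval (K := 16) 3 242 (7 / 10) hd hm (hn' 10 h10) (by omega)
      (by norm_num) (by norm_num) (by norm_num) (by norm_num) (by norm_num) ?_
    norm_num [prod_range_succ, Nat.factorial]
  rcases lt_or_ge T 32 with h32 | h32
  · refine rho_le_qpart_of_mem_interval (K := 30) 4 480 (3 / 4) hd hm (hn' 18 h18) (by omega)
      (by norm_num) (by norm_num) (by norm_num) (by norm_num) (by norm_num) ?_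
    norm_num [prod_range_succ, Nat.factorial]
  · refine rho_le_qpart_of_mem_interval (K := 47) 5 1000 (4 / 5) hd hm (hn' 32 h32) (by omega)
      (by norm_num) (by norm_num) (by norm_num) (by norm_num) (by norm_num) ?_
    norm_num [prod_range_succ, Nat.factorial]

lemma factorial_mul_pow_le {j : ℕ} (hj : 6 ≤ j) :
    (54.6 * (2 / 9) * 39.2 ^ (j + 1) : ℝ) * ((j + 1).factorial * j.factorial) ≤
      (30 * (j + 1) ^ 2) ^ j := by
  induction j, hj using Nat.le_induction with
  | base => norm_num [Nat.factorial]
  | succ j hj ih =>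
    have hj' : (6 : ℝ) ≤ j := by exact_mod_cast hj
    have hbern : (3 : ℝ) * ((j : ℝ) + 1) ^ (2 * (j + 1)) ≤ ((j : ℝ) + 2) ^ (2 * (j + 1)) := by
      have h := one_add_mul_le_pow (a := 1 / ((j : ℝ) + 1))
        (by have : 0 < 1 / ((j : ℝ) + 1) := by positivity
            linarith) (2 * (j + 1))
      have h1 : (1 : ℝ) + ((2 * (j + 1) : ℕ) : ℝ) * (1 / ((j : ℝ) + 1)) = 3 := by
        push_cast; field_simp; norm_num
      have h2 : (1 : ℝ) + 1 / ((j : ℝ) + 1) = (j + 2) / (j + 1) := by field_simp; ring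
      rwa [h1, h2, div_pow, le_div_iff₀ (by positivity)] at h
    rw [Nat.factorial_succ (j + 1), Nat.factorial_succ j] at *
    push_cast at *
    calc (54.6 * (2 / 9) * 39.2 ^ (j + 1 + 1) : ℝ) *
          (((j : ℝ) + 1 + 1) * ((j + 1) * j.factorial) * ((j + 1) * j.factorial))
        = 39.2 * ((j + 2) * (j + 1)) * ((54.6 * (2 / 9) * 39.2 ^ (j + 1)) *
          ((j + 1) * j.factorial * j.factorial)) := by ring
      _ ≤ 39.2 * ((j + 2) * (j + 1)) * (30 * (j + 1) ^ 2) ^ j := by gcongr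
      _ ≤ 90 * ((j + 1) * (j + 1)) * (30 * (j + 1) ^ 2) ^ j := by
        gcongr ?_ * _
        nlinarith
      _ = 30 ^ (j + 1) * (3 * (j + 1) ^ (2 * (j + 1))) := by
        rw [mul_pow, ← pow_mul]; ring
      _ ≤ 30 ^ (j + 1) * (j + 2) ^ (2 * (j + 1)) := by gcongr
      _ = (30 * ((j : ℝ) + 1 + 1) ^ 2) ^ (j + 1) := by
        rw [mul_pow, ← pow_mul]; ring

lemma rho_QminusSet_le_of_lt_sq {m n j : ℕ} (hm : 3 ≤ m) (hj : 7 ≤ j)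
    (hT : 2 * n / (2 * m - 1) < (j + 1) ^ 2) :
    (rho (QminusSet 1 m) n : ℝ) ≤ 54.6 * (2 / 9) * 39.2 ^ j := by
  have hj' : (7 : ℝ) ≤ j := by exact_mod_cast hj
  have hu0 : (0 : ℝ) < j / (j + 2) := by positivity
  have hu1 : (j : ℝ) / (j + 2) < 1 := by rw [div_lt_one (by positivity)]; linarith
  have h1u : 1 - (j : ℝ) / (j + 2) = 2 / (j + 2) := by field_simp; ring
  have hinv : ((j : ℝ) / (j + 2))⁻¹ = 2 / j + 1 := by field_simp; ring
  have hTle : 2 * n / (2 * m - 1) ≤ j * (j + 2) := by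
    have : (j + 1) ^ 2 = j * (j + 2) + 1 := by ring
    omega
  have hpow : (2 / (j : ℝ) + 1) ^ (2 * n / (2 * m - 1)) ≤ Real.exp 4 * Real.exp (2 * j) :=
    calc (2 / (j : ℝ) + 1) ^ (2 * n / (2 * m - 1)) ≤ (2 / (j : ℝ) + 1) ^ (j * (j + 2)) :=
          pow_le_pow_right₀ (by have : 0 < 2 / (j : ℝ) := by positivity
                                linarith) hTle
      _ ≤ Real.exp (2 / j) ^ (j * (j + 2)) := by gcongr; exact Real.add_one_le_exp _
      _ = Real.exp 4 * Real.exp (2 * j) := by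
        rw [← Real.exp_nat_mul, ← Real.exp_add]
        congr 1; push_cast; field_simp; ring
  have hprod : ∀ K, ∏ k ∈ range K, ((1 - ((j : ℝ) / (j + 2)) ^ (k + 1))⁻¹) ^ 2 ≤
      Real.exp (5 / 3 * j) := by
    intro K
    have hnn : ∀ k ∈ range K, 0 ≤ (1 - ((j : ℝ) / (j + 2)) ^ (k + 1))⁻¹ := fun k _ =>
      inv_nonneg.2 (sub_nonneg.2 (pow_le_one₀ hu0.le hu1.le))
    rw [prod_pow]
    refine (pow_le_pow_left₀ (prod_nonneg hnn) (prod_inv_one_sub_pow_le hu0 hu1 K) 2).trans ?_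
    rw [← Real.exp_nat_mul, Real.exp_le_exp, h1u]
    have hpi : Real.pi ^ 2 ≤ 10 := by nlinarith [Real.pi_lt_d2, Real.pi_pos]
    have : ((2 : ℕ) : ℝ) * (Real.pi ^ 2 / 6 * ((j : ℝ) / (j + 2) / (2 / (j + 2)))) =
        Real.pi ^ 2 / 6 * j := by push_cast; field_simp
    rw [this]
    exact mul_le_mul_of_nonneg_right (by linarith) (by positivity)
  have hexp4 : Real.exp 4 ≤ 54.6 := by
    have := Real.exp_one_lt_d9
    rw [show (4 : ℝ) = ((4 : ℕ) : ℝ) * 1 by norm_num, Real.exp_nat_mul]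
    exact (pow_le_pow_left₀ (Real.exp_pos _).le this.le 4).trans (by norm_num)
  have hexp : Real.exp (11 / 3) ≤ 39.2 := by
    refine le_of_pow_le_pow_left₀ three_ne_zero (by norm_num) ?_
    rw [← Real.exp_nat_mul, show ((3 : ℕ) : ℝ) * (11 / 3) = ((11 : ℕ) : ℝ) * 1 by norm_num,
      Real.exp_nat_mul]
    exact (pow_le_pow_left₀ (Real.exp_pos _).le Real.exp_one_lt_d9.le 11).trans (by norm_num)
  refine (rho_QminusSet_le (K := 2 * n / (2 * m - 1)) hm (Nat.le_succ _) hu0 hu1).trans ?_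
  rw [h1u, hinv]
  calc (2 / (j : ℝ) + 1) ^ (2 * n / (2 * m - 1)) * (2 / (j + 2) *
        ∏ k ∈ range (2 * n / (2 * m - 1) + 1), ((1 - ((j : ℝ) / (j + 2)) ^ (k + 1))⁻¹) ^ 2)
      ≤ (Real.exp 4 * Real.exp (2 * j)) * (2 / 9 * Real.exp (5 / 3 * j)) := by
        have h29 : (2 : ℝ) / (j + 2) ≤ 2 / 9 := by gcongr; linarith
        gcongr
        exact hprod _
    _ = Real.exp 4 * (2 / 9) * Real.exp (11 / 3) ^ j := by
        rw [← Real.exp_nat_mul, show (j : ℝ) * (11 / 3) = 2 * j + 5 / 3 * j by ring,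
          Real.exp_add]
        ring
    _ ≤ 54.6 * (2 / 9) * 39.2 ^ j := by gcongr

lemma rho_le_qpart_of_forty_nine_le {d m n : ℕ} (hd : 63 ≤ d) (hm : 3 ≤ m)
    (hn : 2 * n / (2 * m - 1) * (45 * d + 36) ≤ 46 * n)
    (hT49 : 49 ≤ 2 * n / (2 * m - 1)) : rho (QminusSet 1 m) n ≤ qpart 1 d n := by
  obtain ⟨i, hi⟩ : ∃ i, Nat.sqrt (2 * n / (2 * m - 1)) = i + 1 :=
    Nat.exists_eq_add_one.2 (Nat.sqrt_pos.2 (by omega))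
  have hlow : (i + 1) ^ 2 ≤ 2 * n / (2 * m - 1) := hi ▸ Nat.sqrt_le' _
  have hupp : 2 * n / (2 * m - 1) < (i + 1 + 1) ^ 2 := hi ▸ Nat.lt_succ_sqrt' _
  have hi6 : 6 ≤ i := by
    have : 7 ≤ Nat.sqrt (2 * n / (2 * m - 1)) := Nat.le_sqrt'.2 (by omega)
    omega
  refine rho_le_qpart_of_bound (j := i) (a := 30 * (i + 1) ^ 2) hd
    ((Nat.mul_le_mul_right _ hlow).trans hn) (Nat.succ_le_of_lt (by positivity))
    (by nlinarith) (by nlinarith)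
    (rho_QminusSet_le_of_lt_sq hm (by omega) hupp) ?_
  push_cast
  exact factorial_mul_pow_le hi6

theorem stmt9 (N d n : ℕ) (hN : 2 ≤ N) (hd : max 63 (46 * N - 79) ≤ d)
    (hn : d + 2 ≤ n) :
    Qminus 1 (d - N) n ≤ qpart 1 d n := by
  obtain ⟨hd63, hdN⟩ := max_le_iff.1 hd
  unfold Qminus
  generalize hmd : d - N + 3 = m
  have hm46 : 45 * d + 59 ≤ 46 * m := by omega
  have hm3 : 3 ≤ m := by omega
  have hT : 2 * n / (2 * m - 1) * (45 * d + 36) ≤ 46 * n := by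
    have h1 := Nat.div_mul_le_self (2 * n) (2 * m - 1)
    have h2 : 45 * d + 36 ≤ 23 * (2 * m - 1) := by omega
    calc 2 * n / (2 * m - 1) * (45 * d + 36)
        ≤ 2 * n / (2 * m - 1) * (23 * (2 * m - 1)) := Nat.mul_le_mul_left _ h2
      _ = 23 * (2 * n / (2 * m - 1) * (2 * m - 1)) := by ring
      _ ≤ 23 * (2 * n) := Nat.mul_le_mul_left _ h1
      _ = 46 * n := by ring
  rcases Nat.lt_or_ge (2 * n / (2 * m - 1)) 2 with h2 | h2
  · exact (rho_QminusSet_le_two hm3 (by omega)).trans (two_le_qpart (by omega) hn)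
  rcases Nat.lt_or_ge (2 * n / (2 * m - 1)) 49 with h49 | h49
  · exact rho_le_qpart_of_le_forty_eight hd63 hm3 hT h2 (by omega)
  · exact rho_le_qpart_of_forty_nine_le hd63 hm3 hT h49
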